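/- Fix n ∈ ℕ. Let T be a ternary form of degree d = 8+2n and let A ⊂ ℙ^2 be a non-redundant decomposition of T with r = ℓ(A) ≤ 11+3n. Assume that no 5+n points of A lie on a line and no 9+2n points of A lie on a conic (the zero locus of a nonzero homogeneous form of degree 2). Then for every non-redundant decomposition B of T with ℓ(B) ≤ r and B ≠ A, the set Z = A ∪ B does not satisfy the Cayley–Bacharach property CB(d); consequently A ∩ B ≠ ∅. -/

import Mathlib

open MvPolynomial
open scoped Classical

noncomputable section

/-- Points of the projective space `ℙ^m` over `ℂ`. -/
abbrev Pt (m : ℕ) := Projectivization ℂ (Fin (m + 1) → ℂ)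

/-- The linear form with coefficient vector `v`. -/
def linForm {m : ℕ} (v : Fin (m + 1) → ℂ) : MvPolynomial (Fin (m + 1)) ℂ :=
  ∑ i, C (v i) * X i

/-- The degree-`d` Veronese image of a projective point, i.e. the `d`-th power `L^d`
of a linear form `L` representing the point. -/
def powRep {m : ℕ} (d : ℕ) (P : Pt m) : MvPolynomial (Fin (m + 1)) ℂ :=
  linForm P.rep ^ d

/-- `A ⊆ ℙ^m` is a decomposition of the form `T` of degree `d`:
`T = a_1 L_1^d + ⋯ + a_r L_r^d`. -/
def IsDecomp {m : ℕ} (d : ℕ) (A : Finset (Pt m))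
    (T : MvPolynomial (Fin (m + 1)) ℂ) : Prop :=
  ∃ a : Pt m → ℂ, T = ∑ P ∈ A, a P • powRep d P

/-- A decomposition is non-redundant if `T` is not in the span of `ν_d(A')`
for any proper subset `A' ⊊ A`. -/
def NonRedundant {m : ℕ} (d : ℕ) (A : Finset (Pt m))
    (T : MvPolynomial (Fin (m + 1)) ℂ) : Prop :=
  ∀ A' : Finset (Pt m), A' ⊂ A →
    T ∉ Submodule.span ℂ (powRep d '' (A' : Set (Pt m)))

/-- The Cayley–Bacharach property `CB(d)`. -/
def CB {m : ℕ} (d : ℕ) (Z : Finset (Pt m)) : Prop :=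
  ∀ P ∈ Z, ∀ F : MvPolynomial (Fin (m + 1)) ℂ, F.IsHomogeneous d →
    (∀ Q ∈ Z.erase P, eval Q.rep F = 0) → eval P.rep F = 0

/-- The `d`-th Kruskal rank of a finite set `Z ⊂ ℙ^m`: the largest `k` (at most `ℓ(Z)`)
such that the Veronese images of every subset of `Z` of cardinality at most `k`
are linearly independent. -/
def kruskalRank {m : ℕ} (d : ℕ) (Z : Finset (Pt m)) : ℕ :=
  sSup {k | k ≤ Z.card ∧ ∀ S ⊆ Z, S.card ≤ k →
    LinearIndependent ℂ (fun P : S => powRep d P.1)}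

/-- The evaluation map of degree `d` on (representatives of) the points of `Z`. -/
def evalMap {m : ℕ} (Z : Finset (Pt m)) (d : ℕ) :
    homogeneousSubmodule (Fin (m + 1)) ℂ d →ₗ[ℂ] (Z → ℂ) where
  toFun F P := eval (P : Pt m).rep F.1
  map_add' F G := by funext P; simp
  map_smul' c F := by funext P; simp [smul_eq_C_mul]

/-- The Hilbert function of a finite set of points `Z ⊂ ℙ^m`. -/
def hf {m : ℕ} (Z : Finset (Pt m)) (d : ℕ) : ℕ :=
  Module.finrank ℂ (LinearMap.range (evalMap Z d))

/-- The first difference of the Hilbert function (with `h_Z(j) = 0` for `j < 0`). -/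
def Dhf {m : ℕ} (Z : Finset (Pt m)) (j : ℕ) : ℤ :=
  if j = 0 then (hf Z 0 : ℤ) else (hf Z j : ℤ) - (hf Z (j - 1) : ℤ)

lemma finite_hom (k : ℕ) : Module.Finite ℂ (homogeneousSubmodule (Fin 3) ℂ k) :=
  Module.Finite.iff_fg.2 (homogeneousSubmodule_fg (Fin 3) ℂ k)

lemma two_finrank_hom (k : ℕ) :
    2 * Module.finrank ℂ (homogeneousSubmodule (Fin 3) ℂ k) = (k + 1) * (k + 2) := by
  have h1 : Module.finrank ℂ (homogeneousSubmodule (Fin 3) ℂ k)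
      = ((Finset.univ : Finset (Fin 3)).finsuppAntidiag k).card := by
    rw [homogeneousSubmodule_eq_finsupp_supported]
    have hs : {d : Fin 3 →₀ ℕ | d.degree = k}
        = (((Finset.univ : Finset (Fin 3)).finsuppAntidiag k : Finset _) : Set (Fin 3 →₀ ℕ)) := by
      ext d
      simp [Finset.mem_finsuppAntidiag, Finsupp.degree_eq_sum]
    rw [hs]
    have := Module.finrank_eq_nat_card_basis (basisRestrictSupport ℂ
      (((Finset.univ : Finset (Fin 3)).finsuppAntidiag k : Finset _) : Set (Fin 3 →₀ ℕ)))
    rw [Nat.card_eq_fintype_card] at this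
    simp only [Finset.coe_sort_coe, Fintype.card_coe] at this
    exact this
  rw [h1, Finset.card_finsuppAntidiag_nat_eq_choose]
  simp only [Finset.card_univ, Fintype.card_fin]
  have h2 : 3 + k - 1 = k + 2 := by omega
  rw [h2, Nat.choose_symm_add, Nat.choose_two_right]
  have h3 : k + 2 - 1 = k + 1 := by omega
  rw [h3, Nat.mul_div_cancel']
  · ring
  · have := Nat.even_mul_succ_self (k+1)
    rw [mul_comm]; exact this.two_dvd

lemma exists_form (k : ℕ) (S : Finset (Pt 2)) (h : 2 * S.card < (k + 1) * (k + 2)) :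
    ∃ F : MvPolynomial (Fin 3) ℂ, F ≠ 0 ∧ F.IsHomogeneous k ∧ ∀ P ∈ S, eval P.rep F = 0 := by
  have := finite_hom k
  have hlt : Module.finrank ℂ (S → ℂ) < Module.finrank ℂ (homogeneousSubmodule (Fin 3) ℂ k) := by
    have := two_finrank_hom k
    simp only [Module.finrank_fintype_fun_eq_card, Fintype.card_coe]
    omega
  have := LinearMap.ker_ne_bot_of_finrank_lt (f := evalMap S k) hlt
  obtain ⟨F, hF, hF0⟩ := (Submodule.ne_bot_iff _).1 this
  refine ⟨F.1, by simpa using hF0, F.2, fun P hP => ?_⟩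
  exact congrFun (LinearMap.mem_ker.1 hF) ⟨P, hP⟩

lemma exists_lin_ne (P : Pt 2) :
    ∃ L : MvPolynomial (Fin 3) ℂ, L.IsHomogeneous 1 ∧ eval P.rep L ≠ 0 := by
  obtain ⟨i, hi⟩ := Function.ne_iff.1 P.rep_nonzero
  exact ⟨X i, isHomogeneous_X _ i, by simpa using hi⟩

lemma exists_lin_sep {P Q : Pt 2} (h : P ≠ Q) :
    ∃ L : MvPolynomial (Fin 3) ℂ, L.IsHomogeneous 1 ∧ eval Q.rep L = 0 ∧ eval P.rep L ≠ 0 := by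
  by_cases hc : ∃ i j, Q.rep j * P.rep i - Q.rep i * P.rep j ≠ 0
  · obtain ⟨i, j, hij⟩ := hc
    refine ⟨C (Q.rep j) * X i - C (Q.rep i) * X j,
      (isHomogeneous_C_mul_X _ _).sub (isHomogeneous_C_mul_X _ _), ?_, ?_⟩
    · simp; ring
    · simpa using hij
  · exfalso
    push Not at hc
    obtain ⟨j, hj⟩ := Function.ne_iff.1 Q.rep_nonzero
    apply h
    rw [← P.mk_rep, ← Q.mk_rep, Projectivization.mk_eq_mk_iff']
    refine ⟨P.rep j / Q.rep j, ?_⟩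
    funext i
    have := hc i j
    simp only [Pi.zero_apply] at hj
    simp only [Pi.smul_apply, smul_eq_mul]
    field_simp
    linear_combination -this

lemma exists_sep (P : Pt 2) (S : Finset (Pt 2)) : P ∉ S → ∀ k, S.card ≤ k →
    ∃ F : MvPolynomial (Fin 3) ℂ, F.IsHomogeneous k ∧ (∀ Q ∈ S, eval Q.rep F = 0) ∧
      eval P.rep F ≠ 0 := by
  induction S using Finset.induction_on with
  | empty =>
    intro _ k _
    obtain ⟨L, hL, hP⟩ := exists_lin_ne P
    refine ⟨L ^ k, by simpa using hL.pow k, by simp, by simpa using pow_ne_zero k hP⟩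
  | insert Q S hQ ih =>
    intro hP k hk
    rw [Finset.card_insert_of_notMem hQ] at hk
    simp only [Finset.mem_insert, not_or] at hP
    obtain ⟨k, rfl⟩ : ∃ k', k = k' + 1 := ⟨k - 1, by omega⟩
    obtain ⟨F, hF, hS, hFP⟩ := ih hP.2 k (by omega)
    obtain ⟨L, hL, hLQ, hLP⟩ := exists_lin_sep hP.1
    refine ⟨F * L, hF.mul hL, ?_, by simpa using ⟨hFP, hLP⟩⟩
    intro R hR
    rcases Finset.mem_insert.1 hR with rfl | hR
    · simp [hLQ]
    · simp [hS R hR]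

lemma CB_card {d : ℕ} {Z : Finset (Pt 2)} (h : CB d Z) (hne : Z.Nonempty) : d + 2 ≤ Z.card := by
  by_contra hlt
  obtain ⟨P, hP⟩ := hne
  obtain ⟨F, hF, hS, hFP⟩ := exists_sep P (Z.erase P) (by simp) d
    (by rw [Finset.card_erase_of_mem hP]; omega)
  exact hFP (h P hP F hF hS)

lemma CB_resid {d k : ℕ} {Z : Finset (Pt 2)} (h : CB (d + k) Z) {G : MvPolynomial (Fin 3) ℂ}
    (hG : G.IsHomogeneous k) : CB d (Z.filter fun P => eval P.rep G ≠ 0) := by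
  intro P hP F hF hv
  rw [Finset.mem_filter] at hP
  have := h P hP.1 (F * G) (hF.mul hG) (by
    intro Q hQ
    rw [Finset.mem_erase] at hQ
    by_cases hQG : eval Q.rep G = 0
    · simp [hQG]
    · simp [hv Q (by simp [hQ, hQG])])
  simpa [hP.2] using this

lemma CB_pred {d : ℕ} {Z : Finset (Pt 2)} (h : CB (d + 1) Z) : CB d Z := by
  intro P hP F hF hv
  obtain ⟨L, hL, hLP⟩ := exists_lin_ne P
  have := h P hP (F * L) (hF.mul hL) (by
    intro Q hQ
    simp [hv Q hQ])
  simpa [hLP] using this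

/-- `F` is a nonzero form of degree `k` vanishing on `Z`. -/
def Van (k : ℕ) (F : MvPolynomial (Fin 3) ℂ) (Z : Finset (Pt 2)) : Prop :=
  F ≠ 0 ∧ F.IsHomogeneous k ∧ ∀ P ∈ Z, eval P.rep F = 0

lemma card_split (Z : Finset (Pt 2)) (G : MvPolynomial (Fin 3) ℂ) :
    (Z.filter fun P => eval P.rep G = 0).card + (Z.filter fun P => eval P.rep G ≠ 0).card
      = Z.card := Finset.card_filter_add_card_filter_not _

lemma van_mul {k l : ℕ} {F G : MvPolynomial (Fin 3) ℂ} {Z : Finset (Pt 2)}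
    (hF : F ≠ 0) (hFh : F.IsHomogeneous k)
    (hG : Van l G (Z.filter fun P => eval P.rep F ≠ 0)) : Van (l + k) (G * F) Z := by
  refine ⟨mul_ne_zero hG.1 hF, hG.2.1.mul hFh, fun P hP => ?_⟩
  by_cases h : eval P.rep F = 0
  · simp [h]
  · simp [hG.2.2 P (by simp [hP, h])]

lemma line_of_CB (d : ℕ) : ∀ Z : Finset (Pt 2), CB d Z → Z.card ≤ 2 * d + 1 →
    ∃ L, Van 1 L Z := by
  induction d with
  | zero =>
    intro Z h hc
    obtain ⟨L, h1, h2, h3⟩ := exists_form 1 Z (by omega)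
    exact ⟨L, h1, h2, h3⟩
  | succ d ih =>
    intro Z h hc
    by_cases h2 : Z.card ≤ 2
    · obtain ⟨L, h1, h2, h3⟩ := exists_form 1 Z (by omega)
      exact ⟨L, h1, h2, h3⟩
    -- a line with the maximal number of points
    let f : MvPolynomial (Fin 3) ℂ → ℕ := fun L => (Z.filter fun P => eval P.rep L = 0).card
    have hmax : ∃ L : MvPolynomial (Fin 3) ℂ, (L ≠ 0 ∧ L.IsHomogeneous 1) ∧
        ∀ L' : MvPolynomial (Fin 3) ℂ, (L' ≠ 0 ∧ L'.IsHomogeneous 1) → f L' ≤ f L := by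
      let S : Set ℕ := f '' {L | L ≠ 0 ∧ L.IsHomogeneous 1}
      have hfin : S.Finite := (Set.finite_Iic Z.card).subset (by
        rintro _ ⟨L, -, rfl⟩
        exact Finset.card_filter_le _ _)
      obtain ⟨L, hL1, hL2, -⟩ := exists_form 1 ∅ (by simp)
      have hne : S.Nonempty := ⟨f L, L, ⟨hL1, hL2⟩, rfl⟩
      obtain ⟨m, ⟨L, hL, rfl⟩, hm⟩ := hfin.exists_maximal hne
      refine ⟨L, hL, fun L' hL' => ?_⟩
      rcases le_total (f L') (f L) with h | h
      · exact h
      · exact hm ⟨L', hL', rfl⟩ h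
    obtain ⟨L, hL, hLmax⟩ := hmax
    have hm2 : 2 ≤ f L := by
      obtain ⟨S, hSZ, hS⟩ := Finset.exists_subset_card_eq (show 2 ≤ Z.card by omega)
      obtain ⟨M, h1, h2, h3⟩ := exists_form 1 S (by omega)
      refine le_trans ?_ (hLmax M ⟨h1, h2⟩)
      rw [← hS]
      exact Finset.card_le_card fun P hP => by simp [hSZ hP, h3 P hP]
    have hsp := card_split Z L
    have hres := CB_resid h hL.2
    obtain ⟨M, hM⟩ := ih _ hres (by change 2 ≤ Finset.card _ at hm2; omega)
    rcases Finset.eq_empty_or_nonempty (Z.filter fun P => eval P.rep L ≠ 0) with he | hne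
    · refine ⟨L, hL.1, hL.2, fun P hP => ?_⟩
      by_contra hP0
      have : P ∈ (Z.filter fun P => eval P.rep L ≠ 0) := by simp [hP, hP0]
      rw [he] at this
      simp at this
    · have h3 := CB_card hres hne
      have h4 := hLmax M ⟨hM.1, hM.2.1⟩
      have h5 : (Z.filter fun P => eval P.rep L ≠ 0).card ≤ f M :=
        Finset.card_le_card fun P hP => by
          simp [hM.2.2 P hP, (Finset.mem_filter.1 hP).1]
      change _ ≤ Finset.card _ at h4
      omega

lemma CB_weights {d : ℕ} {Z : Finset (Pt 2)} (h : CB d Z) :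
    ∃ c : Z → ℂ, (∀ P, c P ≠ 0) ∧ ∀ F : MvPolynomial (Fin 3) ℂ, F.IsHomogeneous d →
      ∑ P : Z, c P * eval P.1.rep F = 0 := by
  let W := LinearMap.range (evalMap Z d)
  obtain ⟨φ, hφW, hφ⟩ := Module.Dual.exists_forall_mem_ne_zero_of_forall_exists
    (W.dualAnnihilator) (fun P : Z => Module.Dual.eval ℂ (Z → ℂ) (Pi.single P 1)) (by
      intro P
      have hP : (Pi.single P 1 : Z → ℂ) ∉ W := by
        rintro ⟨F, hF⟩
        have h0 := h P.1 P.2 F.1 F.2 (by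
          intro Q hQ
          rw [Finset.mem_erase] at hQ
          have := congrFun hF ⟨Q, hQ.2⟩
          rw [Pi.single_eq_of_ne (by intro h; exact hQ.1 (congrArg Subtype.val h))] at this
          exact this)
        have := congrFun hF P
        rw [Pi.single_eq_same] at this
        exact one_ne_zero (this.symm.trans h0)
      obtain ⟨f, hf1, hf2⟩ := Submodule.exists_dual_map_eq_bot_of_notMem hP inferInstance
      refine ⟨f, ?_, hf1⟩
      rw [Submodule.mem_dualAnnihilator]
      intro w hw
      have : f w ∈ W.map f := Submodule.mem_map_of_mem hw
      rw [hf2] at this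
      simpa using this)
  refine ⟨fun P => φ (Pi.single P 1), hφ, fun F hF => ?_⟩
  have h1 := (Submodule.mem_dualAnnihilator φ).1 hφW (evalMap Z d ⟨F, hF⟩) ⟨_, rfl⟩
  rw [LinearMap.pi_apply_eq_sum_univ φ] at h1
  rw [← h1]
  refine Finset.sum_congr rfl fun P _ => ?_
  rw [smul_eq_mul, mul_comm]
  congr 1
  refine congrArg φ ?_
  funext Q
  simp [Pi.single_apply, eq_comm]

lemma CB_orth {j k : ℕ} {Z : Finset (Pt 2)} (h : CB (j + k) Z) :
    hf Z j + hf Z k ≤ Z.card := by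
  obtain ⟨c, hc, hrel⟩ := CB_weights h
  let Φ : (Z → ℂ) →ₗ[ℂ] Module.Dual ℂ (Z → ℂ) :=
    LinearMap.mk₂ ℂ (fun u w => ∑ P, c P * (u P * w P))
      (by intros; simp [add_mul, mul_add, Finset.sum_add_distrib])
      (by intros; simp [Finset.mul_sum]; exact Finset.sum_congr rfl fun _ _ => by ring)
      (by intros; simp [mul_add, Finset.sum_add_distrib])
      (by intros; simp [Finset.mul_sum]; exact Finset.sum_congr rfl fun _ _ => by ring)
  have hΦ : ∀ u w, Φ u w = ∑ P, c P * (u P * w P) := fun u w => rfl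
  have hinj : Function.Injective Φ := by
    rw [← LinearMap.ker_eq_bot, LinearMap.ker_eq_bot']
    intro u hu
    funext P
    have := congrArg (fun f => f (Pi.single P 1)) hu
    simp only [hΦ, LinearMap.zero_apply] at this
    simpa [Pi.single_apply, hc] using this
  have hle : (LinearMap.range (evalMap Z j)).map Φ ≤
      (LinearMap.range (evalMap Z k)).dualAnnihilator := by
    rintro _ ⟨_, ⟨F, rfl⟩, rfl⟩
    rw [Submodule.mem_dualAnnihilator]
    rintro _ ⟨G, rfl⟩
    rw [hΦ]
    have := hrel (F.1 * G.1) (F.2.mul G.2)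
    simpa [evalMap] using this
  have h1 := Submodule.finrank_mono hle
  have h2 : Module.finrank ℂ ((LinearMap.range (evalMap Z j)).map Φ) = hf Z j :=
    (Submodule.equivMapOfInjective Φ hinj _).finrank_eq.symm
  have h3 := Subspace.finrank_add_finrank_dualAnnihilator_eq (LinearMap.range (evalMap Z k))
  simp only [Module.finrank_fintype_fun_eq_card, Fintype.card_coe] at h3
  change hf Z k + _ = _ at h3
  omega

lemma hf_add_ker (Z : Finset (Pt 2)) (k : ℕ) :
    2 * hf Z k + 2 * Module.finrank ℂ (LinearMap.ker (evalMap Z k)) = (k + 1) * (k + 2) := by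
  have := finite_hom k
  rw [← two_finrank_hom, ← LinearMap.finrank_range_add_finrank_ker (evalMap Z k)]
  unfold hf
  ring

lemma hf_big {Z : Finset (Pt 2)} {k : ℕ} (h : Z.card ≤ k) : hf Z k = Z.card := by
  have hs : LinearMap.range (evalMap Z k) = ⊤ := by
    rw [eq_top_iff]
    intro u _
    rw [show u = ∑ P, u P • (Pi.single P 1 : Z → ℂ) by
      funext Q; simp [Pi.single_apply]]
    refine Submodule.sum_mem _ fun P _ => Submodule.smul_mem _ _ ?_
    obtain ⟨F, hF, hS, hFP⟩ := exists_sep P.1 (Z.erase P.1) (by simp) k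
      (by rw [Finset.card_erase_of_mem P.2]; omega)
    refine ⟨(eval P.1.rep F)⁻¹ • ⟨F, hF⟩, ?_⟩
    rw [map_smul]
    funext Q
    by_cases hQ : Q = P
    · subst hQ
      simp [evalMap, hFP]
    · have : Q.1 ≠ P.1 := fun h => hQ (Subtype.ext h)
      have h0 := hS Q.1 (by simp [this])
      simp [evalMap, hQ, h0]
  unfold hf
  rw [hs]
  simp

/-- Multiplication by a form, between graded pieces. -/
def mulH {a : ℕ} (E : MvPolynomial (Fin 3) ℂ) (hE : E.IsHomogeneous a) (m : ℕ) :
    homogeneousSubmodule (Fin 3) ℂ m →ₗ[ℂ] homogeneousSubmodule (Fin 3) ℂ (a + m) where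
  toFun F := ⟨E * F.1, hE.mul F.2⟩
  map_add' F G := by ext1; simp [mul_add]
  map_smul' c F := by ext1; simp

lemma hom_quot {a m : ℕ} {E F : MvPolynomial (Fin 3) ℂ} (hE : E.IsHomogeneous a)
    (hF : F.IsHomogeneous (a + m)) (h : E ∣ F) :
    ∃ q : MvPolynomial (Fin 3) ℂ, q.IsHomogeneous m ∧ F = E * q := by
  obtain ⟨q, rfl⟩ := h
  refine ⟨homogeneousComponent m q, homogeneousComponent_isHomogeneous _ _, ?_⟩
  have h1 := homogeneousComponent_eq_self hF
  conv_lhs => rw [← h1]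
  have h2 : E * q = ∑ i ∈ Finset.range (q.totalDegree + 1), E * homogeneousComponent i q := by
    rw [← Finset.mul_sum, sum_homogeneousComponent]
  rw [h2, map_sum]
  have h3 : ∀ i, homogeneousComponent (a + m) (E * homogeneousComponent i q) =
      if i = m then E * homogeneousComponent i q else 0 := by
    intro i
    rw [homogeneousComponent_of_mem (hE.mul (homogeneousComponent_isHomogeneous i q))]
    by_cases hi : i = m
    · simp [hi]
    · rw [if_neg (by omega), if_neg hi]
  simp only [h3]
  rw [Finset.sum_ite_eq']
  split_ifs with h4
  · rfl
  · rw [homogeneousComponent_eq_zero, mul_zero]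
    simp at h4; omega

lemma top_ne_zero {a : MvPolynomial (Fin 3) ℂ} (ha : a ≠ 0) :
    homogeneousComponent a.totalDegree a ≠ 0 := by
  intro h
  obtain ⟨m, hm, hd⟩ := Finset.exists_mem_eq_sup a.support (support_nonempty.2 ha)
    (fun s => s.sum fun _ e => e)
  have h1 : m.degree = a.totalDegree := hd.symm
  have := congrArg (coeff m) h
  rw [coeff_homogeneousComponent, if_pos h1] at this
  exact (mem_support_iff.1 hm) (by simpa using this)

lemma hom_factor {d : ℕ} {a b : MvPolynomial (Fin 3) ℂ} (h0 : a * b ≠ 0)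
    (h : (a * b).IsHomogeneous d) :
    a.totalDegree + b.totalDegree = d ∧
      a * b = homogeneousComponent a.totalDegree a * homogeneousComponent b.totalDegree b := by
  have ha : a ≠ 0 := left_ne_zero_of_mul h0
  have hb : b ≠ 0 := right_ne_zero_of_mul h0
  have key : homogeneousComponent (a.totalDegree + b.totalDegree) (a * b) =
      homogeneousComponent a.totalDegree a * homogeneousComponent b.totalDegree b := by
    have h2 : a * b = ∑ i ∈ Finset.range (a.totalDegree + 1),
        ∑ j ∈ Finset.range (b.totalDegree + 1),
          homogeneousComponent i a * homogeneousComponent j b := by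
      rw [← Finset.sum_mul_sum, sum_homogeneousComponent, sum_homogeneousComponent]
    conv_lhs => rw [h2]
    simp only [map_sum]
    rw [Finset.sum_eq_single a.totalDegree, Finset.sum_eq_single b.totalDegree]
    · exact homogeneousComponent_eq_self
        ((homogeneousComponent_isHomogeneous _ _).mul (homogeneousComponent_isHomogeneous _ _))
    · intro j hj hne
      rw [homogeneousComponent_of_mem
        ((homogeneousComponent_isHomogeneous _ a).mul (homogeneousComponent_isHomogeneous _ b)),
        if_neg (by omega)]
    · simp
    · intro i hi hne
      refine Finset.sum_eq_zero fun j hj => ?_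
      rw [Finset.mem_range] at hi hj
      rw [homogeneousComponent_of_mem
        ((homogeneousComponent_isHomogeneous _ a).mul (homogeneousComponent_isHomogeneous _ b)),
        if_neg (by omega)]
    · simp
  have hd : a.totalDegree + b.totalDegree = d := by
    by_contra hne
    rw [homogeneousComponent_of_mem h, if_neg hne] at key
    exact mul_ne_zero (top_ne_zero ha) (top_ne_zero hb) key.symm
  refine ⟨hd, ?_⟩
  rw [← key, hd, homogeneousComponent_eq_self h]

lemma isUnit_of_totalDegree {a : MvPolynomial (Fin 3) ℂ} (ha : a ≠ 0) (h : a.totalDegree = 0) :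
    IsUnit a := by
  rw [totalDegree_eq_zero_iff_eq_C] at h
  rw [h] at ha ⊢
  have : coeff 0 a ≠ 0 := fun h0 => ha (by simp [h0])
  exact (IsUnit.mk0 _ this).map C

lemma bezout {k : ℕ} {E G : MvPolynomial (Fin 3) ℂ} {Z : Finset (Pt 2)} (hEp : Prime E)
    (hE : E.IsHomogeneous 3) (hG : G.IsHomogeneous k) (hEG : ¬ E ∣ G)
    (hEZ : ∀ P ∈ Z, eval P.rep E = 0) (hGZ : ∀ P ∈ Z, eval P.rep G = 0) :
    Z.card ≤ 3 * k := by
  set N := Z.card with hN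
  have i1 := finite_hom (k + N)
  have i2 := finite_hom (3 + N)
  have i3 := finite_hom N
  have i4 := finite_hom (3 + (k + N))
  have i5 := finite_hom (k + (3 + N))
  let V := MvPolynomial (Fin 3) ℂ
  let Ψ : (homogeneousSubmodule (Fin 3) ℂ (k + N) × homogeneousSubmodule (Fin 3) ℂ (3 + N))
      →ₗ[ℂ] V :=
    LinearMap.coprod ((Submodule.subtype _).comp (mulH E hE (k + N)))
      ((Submodule.subtype _).comp (mulH G hG (3 + N)))
  have hΨ : ∀ x, Ψ x = E * x.1.1 + G * x.2.1 := fun x => rfl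
  let Θ : homogeneousSubmodule (Fin 3) ℂ N →ₗ[ℂ]
      (homogeneousSubmodule (Fin 3) ℂ (k + N) × homogeneousSubmodule (Fin 3) ℂ (3 + N)) :=
    LinearMap.prod (-(mulH G hG N)) (mulH E hE N)
  have hker : LinearMap.ker Ψ ≤ LinearMap.range Θ := by
    rintro ⟨A, B⟩ hAB
    rw [LinearMap.mem_ker, hΨ] at hAB
    simp only at hAB
    have hdvd : E ∣ G * B.1 := ⟨-A.1, by linear_combination hAB⟩
    have hB := (hEp.dvd_or_dvd hdvd).resolve_left hEG
    obtain ⟨q, hq, hBq⟩ := hom_quot hE B.2 hB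
    refine ⟨⟨q, hq⟩, Prod.ext (Subtype.ext ?_) (Subtype.ext ?_)⟩
    · change -(G * q) = A.1
      apply mul_left_cancel₀ hEp.ne_zero
      rw [hBq] at hAB
      linear_combination -hAB
    · exact hBq.symm
  have hrange : LinearMap.range Ψ ≤
      (LinearMap.ker (evalMap Z (3 + (k + N)))).map (Submodule.subtype _) := by
    rintro _ ⟨x, rfl⟩
    have hx : (Ψ x).IsHomogeneous (3 + (k + N)) := by
      rw [hΨ]
      refine (hE.mul x.1.2).add ?_
      have := hG.mul x.2.2
      rwa [show k + (3 + N) = 3 + (k + N) by ring] at this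
    refine ⟨⟨Ψ x, hx⟩, ?_, rfl⟩
    change evalMap Z _ _ = 0
    funext P
    change eval P.1.rep (Ψ x) = 0
    rw [hΨ]
    simp [hEZ P.1 P.2, hGZ P.1 P.2]
  have f1 := LinearMap.finrank_range_add_finrank_ker Ψ
  rw [Module.finrank_prod] at f1
  have f2 := Submodule.finrank_mono hker
  have f3 := LinearMap.finrank_range_le Θ
  have f4 := Submodule.finrank_mono hrange
  have f5 := Submodule.finrank_map_le (Submodule.subtype _)
    (LinearMap.ker (evalMap Z (3 + (k + N))))
  have f6 := hf_add_ker Z (3 + (k + N))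
  rw [hf_big (by omega)] at f6
  have g1 := two_finrank_hom (k + N)
  have g2 := two_finrank_hom (3 + N)
  have g3 := two_finrank_hom N
  nlinarith

lemma exists_nondvd {e : ℕ} {E : MvPolynomial (Fin 3) ℂ} {Z : Finset (Pt 2)}
    (hE : E.IsHomogeneous 3) (h : hf Z (3 + e) < 3 * (3 + e)) :
    ∃ G : MvPolynomial (Fin 3) ℂ, G.IsHomogeneous (3 + e) ∧ ¬ E ∣ G ∧
      ∀ P ∈ Z, eval P.rep G = 0 := by
  by_contra hcon
  push Not at hcon
  have i1 := finite_hom e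
  have i2 := finite_hom (3 + e)
  have hle : LinearMap.ker (evalMap Z (3 + e)) ≤ LinearMap.range (mulH E hE e) := by
    intro G hG
    by_cases hd : E ∣ G.1
    · obtain ⟨q, hq, hGq⟩ := hom_quot hE G.2 hd
      exact ⟨⟨q, hq⟩, Subtype.ext hGq.symm⟩
    · obtain ⟨P, hP, hne⟩ := hcon G.1 G.2 hd
      exact absurd (congrFun (LinearMap.mem_ker.1 hG) ⟨P, hP⟩) hne
  have f1 := Submodule.finrank_mono hle
  have f2 := LinearMap.finrank_range_le (mulH E hE e)
  have f3 := hf_add_ker Z (3 + e)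
  have g1 := two_finrank_hom e
  nlinarith

lemma apolar_mon {Z : Finset (Pt 2)} (k : ℕ) : ∀ (m : Fin 3 →₀ ℕ) (c : Pt 2 → ℂ), m.degree = k →
    ∑ P ∈ Z, c P • powRep k P = 0 → ∑ P ∈ Z, c P * eval P.rep (monomial m (1 : ℂ)) = 0 := by
  induction k with
  | zero =>
    intro m c hm h
    have hm0 : m = 0 := (Finsupp.degree_eq_zero_iff m).1 hm
    subst hm0
    have := congrArg (eval 0) h
    simpa [powRep, smul_eval] using this
  | succ k ih =>
    intro m c hm h
    have : m ≠ 0 := by rintro rfl; simp at hm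
    obtain ⟨i, hi⟩ := Finsupp.ne_iff.1 this
    simp only [Finsupp.coe_zero, Pi.zero_apply] at hi
    have hle : Finsupp.single i 1 ≤ m := by simpa using Nat.one_le_iff_ne_zero.2 hi
    obtain ⟨m', rfl⟩ := exists_add_of_le hle
    have hd : m'.degree = k := by
      rw [map_add, Finsupp.degree_single] at hm; omega
    have hpd : ∀ P : Pt 2, pderiv i (powRep (k + 1) P) = ((k + 1 : ℂ) * P.rep i) • powRep k P := by
      intro P
      have hl : pderiv i (linForm P.rep) = C (P.rep i) := by
        simp [linForm, pderiv_X, Pi.single_apply]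
      unfold powRep
      rw [pderiv_pow, hl, smul_eq_C_mul]
      simp
      ring
    have h2 := congrArg (pderiv i) h
    simp only [map_sum, map_zero] at h2
    have h3 := ih m' (fun P => c P * ((k + 1 : ℂ) * P.rep i)) hd (by
      rw [← h2]
      exact Finset.sum_congr rfl fun P _ => by rw [Derivation.map_smul, hpd, smul_smul])
    have hk : (k + 1 : ℂ) ≠ 0 := by exact_mod_cast Nat.succ_ne_zero k
    apply mul_left_cancel₀ hk
    rw [mul_zero, ← h3, Finset.mul_sum]
    refine Finset.sum_congr rfl fun P _ => ?_
    have : (monomial (Finsupp.single i 1 + m') (1 : ℂ)) = X i * monomial m' 1 := by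
      rw [X, monomial_mul, one_mul]
    rw [this]
    simp only [map_mul, eval_X]
    ring

lemma apolar {Z : Finset (Pt 2)} {d : ℕ} {c : Pt 2 → ℂ} (h : ∑ P ∈ Z, c P • powRep d P = 0)
    {F : MvPolynomial (Fin 3) ℂ} (hF : F.IsHomogeneous d) :
    ∑ P ∈ Z, c P * eval P.rep F = 0 := by
  have h1 : ∀ P : Pt 2, eval P.rep F =
      ∑ m ∈ F.support, coeff m F * eval P.rep (monomial m (1 : ℂ)) := by
    intro P
    conv_lhs => rw [F.as_sum]
    rw [map_sum]
    refine Finset.sum_congr rfl fun m _ => ?_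
    simp [eval_monomial]
  simp only [h1, Finset.mul_sum]
  rw [Finset.sum_comm]
  refine Finset.sum_eq_zero fun m hm => ?_
  have hdeg : m.degree = d := by
    by_contra hne
    exact (mem_support_iff.1 hm) (hF.coeff_eq_zero hne)
  have := apolar_mon d m c hdeg h
  calc _ = coeff m F * ∑ P ∈ Z, c P * eval P.rep (monomial m (1 : ℂ)) := by
        rw [Finset.mul_sum]
        exact Finset.sum_congr rfl fun P _ => by ring
    _ = 0 := by rw [this, mul_zero]

lemma conic_of_CB (d : ℕ) : ∀ Z : Finset (Pt 2), CB d Z → Z.card + 2 ≤ 3 * d →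
    ∃ Q, Van 2 Q Z := by
  induction d using Nat.strong_induction_on with
  | _ d ih =>
  intro Z h hc
  have two_lines : ∀ L M, Van 1 L (Z.filter fun P => eval P.rep M ≠ 0) → M ≠ 0 →
      M.IsHomogeneous 1 → ∃ Q, Van 2 Q Z := fun L M hL hM hM1 => ⟨_, van_mul hM hM1 hL⟩
  by_cases hsmall : Z.card ≤ 2 * d + 1
  · obtain ⟨L, hL⟩ := line_of_CB d Z h hsmall
    exact two_lines L L ⟨hL.1, hL.2.1, fun P hP => hL.2.2 P (Finset.mem_filter.1 hP).1⟩ hL.1 hL.2.1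
  obtain ⟨d, rfl⟩ : ∃ d', d = d' + 4 := ⟨d - 4, by omega⟩
  by_cases hpred : Z.card + 2 ≤ 3 * (d + 3)
  · exact ih (d + 3) (by omega) Z (CB_pred h) hpred
  by_contra hno
  have sub_of_empty : ∀ F : MvPolynomial (Fin 3) ℂ,
      (Z.filter fun P => eval P.rep F ≠ 0) = ∅ → ∀ P ∈ Z, eval P.rep F = 0 := by
    intro F hF P hP
    by_contra hne
    have : P ∈ (Z.filter fun P => eval P.rep F ≠ 0) := by simp [hP, hne]
    rw [hF] at this
    simp at this
  have conic_ne : ∀ F : MvPolynomial (Fin 3) ℂ, F ≠ 0 → F.IsHomogeneous 2 →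
      (Z.filter fun P => eval P.rep F ≠ 0).Nonempty := by
    intro F hF hF2
    by_contra hne
    exact hno ⟨F, hF, hF2, sub_of_empty F (Finset.not_nonempty_iff_eq_empty.1 hne)⟩
  -- no three points on a line
  have hline : ∀ L : MvPolynomial (Fin 3) ℂ, L ≠ 0 → L.IsHomogeneous 1 →
      (Z.filter fun P => eval P.rep L = 0).card ≤ 2 := by
    intro L hL hL1
    by_contra hgt
    have hsp := card_split Z L
    have hres : CB (d + 3) _ := CB_resid (d := d + 3) (k := 1) h hL1
    obtain ⟨Q, hQ⟩ := ih (d + 3) (by omega) _ hres (by omega)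
    have hres2 : CB (d + 2) _ := CB_resid (d := d + 2) (k := 2) h hQ.2.1
    have hbig := CB_card hres2 (conic_ne Q hQ.1 hQ.2.1)
    have hsub : (Z.filter fun P => eval P.rep Q ≠ 0).card ≤
        (Z.filter fun P => eval P.rep L = 0).card := Finset.card_le_card (by
      intro P hP
      rw [Finset.mem_filter] at hP ⊢
      refine ⟨hP.1, ?_⟩
      by_contra hne
      exact hP.2 (hQ.2.2 P (by simp [hP.1, hne])))
    obtain ⟨M, hM⟩ := line_of_CB _ _ hres (by omega)
    exact hno (two_lines M L hM hL hL1)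
  have hlineW : ∀ W ⊆ Z, ∀ L, Van 1 L W → W.card ≤ 2 := by
    intro W hW L hL
    refine le_trans (Finset.card_le_card ?_) (hline L hL.1 hL.2.1)
    intro P hP
    simp [hW hP, hL.2.2 P hP]
  -- no six points on a conic
  have hconic : ∀ Q : MvPolynomial (Fin 3) ℂ, Q ≠ 0 → Q.IsHomogeneous 2 →
      (Z.filter fun P => eval P.rep Q = 0).card ≤ 5 := by
    intro Q hQ hQ2
    by_contra hgt
    have hsp := card_split Z Q
    have hres : CB (d + 2) _ := CB_resid (d := d + 2) (k := 2) h hQ2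
    obtain ⟨R, hR⟩ := ih (d + 2) (by omega) _ hres (by omega)
    have big : ∀ F : MvPolynomial (Fin 3) ℂ, F ≠ 0 → F.IsHomogeneous 2 →
        2 * (d + 2) + 2 ≤ (Z.filter fun P => eval P.rep F ≠ 0).card := by
      intro F hF hF2
      have hresF : CB (d + 2) _ := CB_resid (d := d + 2) (k := 2) h hF2
      have h1 := CB_card hresF (conic_ne F hF hF2)
      by_contra hlt
      obtain ⟨L, hL⟩ := line_of_CB _ _ hresF (by omega)
      have := hlineW _ (Finset.filter_subset _ _) L hL
      omega
    have b1 := big Q hQ hQ2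
    have b2 := big R hR.1 hR.2.1
    have hsub : (Z.filter fun P => eval P.rep R ≠ 0).card ≤
        (Z.filter fun P => eval P.rep Q = 0).card := Finset.card_le_card (by
      intro P hP
      rw [Finset.mem_filter] at hP ⊢
      refine ⟨hP.1, ?_⟩
      by_contra hne
      exact hP.2 (hR.2.2 P (by simp [hP.1, hne])))
    omega
  have hconicW : ∀ W ⊆ Z, ∀ L, Van 2 L W → W.card ≤ 5 := by
    intro W hW L hL
    refine le_trans (Finset.card_le_card ?_) (hconic L hL.1 hL.2.1)
    intro P hP
    simp [hW hP, hL.2.2 P hP]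
  -- the cubic
  obtain ⟨S, hSZ, hS⟩ := Finset.exists_subset_card_eq (show 9 ≤ Z.card by omega)
  obtain ⟨E, hE0, hE3, hES⟩ := exists_form 3 S (by omega)
  have h9 : 9 ≤ (Z.filter fun P => eval P.rep E = 0).card := by
    rw [← hS]
    exact Finset.card_le_card fun P hP => by simp [hSZ hP, hES P hP]
  have hEZ : ∀ P ∈ Z, eval P.rep E = 0 := by
    apply sub_of_empty
    by_contra hne
    have hne := Finset.nonempty_iff_ne_empty.2 hne
    have hres : CB (d + 1) _ := CB_resid (d := d + 1) (k := 3) h hE3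
    have hsp := card_split Z E
    obtain ⟨Q, hQ⟩ := ih (d + 1) (by omega) _ hres (by omega)
    have h5 := hconicW _ (Finset.filter_subset _ _) Q hQ
    have h6 := CB_card hres hne
    by_cases hle : (Z.filter fun P => eval P.rep E ≠ 0).card ≤ 2 * (d + 1) + 1
    · obtain ⟨L, hL⟩ := line_of_CB _ _ hres hle
      have := hlineW _ (Finset.filter_subset _ _) L hL
      omega
    · omega
  -- irreducibility of the cubic
  have hirr : Irreducible E := by
    constructor
    · intro hu
      obtain ⟨b, hb⟩ := hu.exists_right_inv
      have h1 : (E * b).IsHomogeneous 0 := by rw [hb]; exact isHomogeneous_one _ _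
      have h2 := (hom_factor (by rw [hb]; exact one_ne_zero) h1).1
      rw [hE3.totalDegree hE0] at h2
      omega
    · rintro a b rfl
      by_contra hcon
      push Not at hcon
      have ha := left_ne_zero_of_mul hE0
      have hb := right_ne_zero_of_mul hE0
      obtain ⟨hdeg, hab⟩ := hom_factor hE0 hE3
      have ha1 : a.totalDegree ≠ 0 := fun h0 => hcon.1 (isUnit_of_totalDegree ha h0)
      have hb1 : b.totalDegree ≠ 0 := fun h0 => hcon.2 (isUnit_of_totalDegree hb h0)
      have key : ∀ F : MvPolynomial (Fin 3) ℂ, F ≠ 0 → (F.IsHomogeneous 1 ∨ F.IsHomogeneous 2) →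
          (Z.filter fun P => eval P.rep F = 0).card ≤ 5 := by
        rintro F hF (h1 | h2)
        · have := hline F hF h1; omega
        · exact hconic F hF h2
      have hcomp : ∀ x : MvPolynomial (Fin 3) ℂ, (x.totalDegree = 1 ∨ x.totalDegree = 2) →
          ((homogeneousComponent x.totalDegree x).IsHomogeneous 1 ∨
            (homogeneousComponent x.totalDegree x).IsHomogeneous 2) := by
        rintro x (hx | hx)
        · left; have := homogeneousComponent_isHomogeneous x.totalDegree x; rwa [hx] at this ⊢
        · right; have := homogeneousComponent_isHomogeneous x.totalDegree x; rwa [hx] at this ⊢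
      have k1 := key _ (top_ne_zero ha) (hcomp a (by omega))
      have k2 := key _ (top_ne_zero hb) (hcomp b (by omega))
      have hsp := card_split Z (homogeneousComponent a.totalDegree a)
      have hsub : (Z.filter fun P => eval P.rep (homogeneousComponent a.totalDegree a) ≠ 0).card ≤
          (Z.filter fun P => eval P.rep (homogeneousComponent b.totalDegree b) = 0).card :=
        Finset.card_le_card (by
          intro P hP
          rw [Finset.mem_filter] at hP ⊢
          refine ⟨hP.1, ?_⟩
          have := hEZ P hP.1
          rw [hab, map_mul] at this
          exact (mul_eq_zero.1 this).resolve_left hP.2)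
      have hZ10 : Z.card = 10 := by omega
      -- one factor is a line
      have l1 : (Z.filter fun P => eval P.rep (homogeneousComponent a.totalDegree a) = 0).card ≤ 2
          ∨ (Z.filter fun P => eval P.rep (homogeneousComponent b.totalDegree b) = 0).card
            ≤ 2 := by
        rcases (show a.totalDegree = 1 ∨ b.totalDegree = 1 by omega) with hx | hx
        · left
          have := homogeneousComponent_isHomogeneous a.totalDegree a
          exact hline _ (top_ne_zero ha) (by rwa [hx] at this ⊢)
        · right
          have := homogeneousComponent_isHomogeneous b.totalDegree b
          exact hline _ (top_ne_zero hb) (by rwa [hx] at this ⊢)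
      omega
  -- Hilbert function in degree 2
  have hf2 : hf Z 2 = 6 := by
    have hk : LinearMap.ker (evalMap Z 2) = ⊥ := by
      rw [LinearMap.ker_eq_bot']
      intro F hF
      by_contra hne
      exact hno ⟨F.1, by simpa using hne, F.2, fun P hP => congrFun hF ⟨P, hP⟩⟩
    have := hf_add_ker Z 2
    rw [hk, finrank_bot] at this
    omega
  have horth := CB_orth (j := 2) (k := d + 2) (Z := Z) (by rwa [show 2 + (d + 2) = d + 4 by ring])
  rcases Nat.eq_zero_or_pos d with rfl | hd
  · simp only [zero_add] at horth
    omega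
  obtain ⟨e, rfl⟩ : ∃ e, d = e + 1 := ⟨d - 1, by omega⟩
  have he : e + 1 + 2 = 3 + e := by ring
  rw [he] at horth
  obtain ⟨G, hG, hEG, hGZ⟩ := exists_nondvd (Z := Z) (e := e) hE3 (by omega)
  have := bezout (Z := Z) hirr.prime hE3 hG hEG hEZ hGZ
  omega

lemma coeff_ne_zero_of_nonRedundant {d : ℕ} {A : Finset (Pt 2)} {T : MvPolynomial (Fin 3) ℂ}
    {a : Pt 2 → ℂ} (ha : T = ∑ P ∈ A, a P • powRep d P) (hA : NonRedundant d A T) :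
    ∀ P ∈ A, a P ≠ 0 := by
  intro P hP h0
  refine hA (A.erase P) (Finset.erase_ssubset hP) ?_
  rw [ha, ← Finset.add_sum_erase _ _ hP, h0, zero_smul, zero_add]
  exact Submodule.sum_mem _ fun Q hQ => Submodule.smul_mem _ _
    (Submodule.subset_span ⟨Q, hQ, rfl⟩)

lemma CB_of_disjoint {d : ℕ} {A B : Finset (Pt 2)} {T : MvPolynomial (Fin 3) ℂ}
    (hA : IsDecomp d A T) (hAnr : NonRedundant d A T)
    (hB : IsDecomp d B T) (hBnr : NonRedundant d B T) (hdis : Disjoint A B) : CB d (A ∪ B) := by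
  obtain ⟨a, ha⟩ := hA
  obtain ⟨b, hb⟩ := hB
  have ha0 := coeff_ne_zero_of_nonRedundant ha hAnr
  have hb0 := coeff_ne_zero_of_nonRedundant hb hBnr
  let c : Pt 2 → ℂ := fun P => if P ∈ A then a P else - b P
  have hcB : ∀ P ∈ B, c P = - b P := fun P hP => if_neg (Finset.disjoint_right.1 hdis hP)
  have hcA : ∀ P ∈ A, c P = a P := fun P hP => if_pos hP
  have hc : ∀ P ∈ A ∪ B, c P ≠ 0 := by
    intro P hP
    rcases Finset.mem_union.1 hP with hP | hP
    · rw [hcA P hP]; exact ha0 P hP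
    · rw [hcB P hP]; exact neg_ne_zero.2 (hb0 P hP)
  have hsum : ∑ P ∈ A ∪ B, c P • powRep d P = 0 := by
    rw [Finset.sum_union hdis, Finset.sum_congr rfl fun P hP => by rw [hcA P hP], ← ha,
      Finset.sum_congr rfl fun P hP => by rw [hcB P hP, neg_smul], Finset.sum_neg_distrib, ← hb,
      add_neg_cancel]
  intro P hP F hF hv
  have := apolar hsum hF
  rw [← Finset.add_sum_erase _ _ hP, Finset.sum_eq_zero, add_zero] at this
  · exact (mul_eq_zero.1 this).resolve_left (hc P hP)
  · intro Q hQ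
    rw [hv Q hQ, mul_zero]

/-- If no `5+n` points of `A` lie on a line and no `9+2n` points of `A`
lie on a conic, then for every non-redundant decomposition `B ≠ A` of `T` with
`ℓ(B) ≤ ℓ(A)`, the set `Z = A ∪ B` does not satisfy `CB(d)`; consequently `A ∩ B ≠ ∅`. -/
theorem stmt2 (n : ℕ) (T : MvPolynomial (Fin 3) ℂ) (hT0 : T ≠ 0)
    (hThom : T.IsHomogeneous (8 + 2 * n))
    (A : Finset (Pt 2)) (hA : IsDecomp (8 + 2 * n) A T)
    (hAnr : NonRedundant (8 + 2 * n) A T)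
    (hr : A.card ≤ 11 + 3 * n)
    (hline : ¬ ∃ A' ⊆ A, 5 + n ≤ A'.card ∧
      ∃ L : MvPolynomial (Fin 3) ℂ, L ≠ 0 ∧ L.IsHomogeneous 1 ∧
        ∀ P ∈ A', eval (Projectivization.rep P) L = 0)
    (hconic : ¬ ∃ A' ⊆ A, 9 + 2 * n ≤ A'.card ∧
      ∃ Q : MvPolynomial (Fin 3) ℂ, Q ≠ 0 ∧ Q.IsHomogeneous 2 ∧
        ∀ P ∈ A', eval (Projectivization.rep P) Q = 0) :
    ∀ B : Finset (Pt 2), IsDecomp (8 + 2 * n) B T → NonRedundant (8 + 2 * n) B T →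
      B.card ≤ A.card → B ≠ A →
        ¬ CB (8 + 2 * n) (A ∪ B) ∧ (A ∩ B).Nonempty := by
  intro B hB hBnr hBA _
  have hAne : A.Nonempty := by
    rw [Finset.nonempty_iff_ne_empty]
    rintro rfl
    obtain ⟨a, ha⟩ := hA
    exact hT0 (by simpa using ha)
  have hcard := Finset.card_union_le A B
  have hnot : ¬ CB (8 + 2 * n) (A ∪ B) := by
    intro hCB
    obtain ⟨Q, hQ⟩ := conic_of_CB _ _ hCB (by omega)
    have h1 : A.card < 9 + 2 * n := by
      by_contra hge
      exact hconic ⟨A, subset_rfl, by omega, Q, hQ.1, hQ.2.1,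
        fun P hP => hQ.2.2 P (Finset.mem_union_left _ hP)⟩
    obtain ⟨L, hL⟩ := line_of_CB _ _ hCB (by omega)
    have h2 : A.card < 5 + n := by
      by_contra hge
      exact hline ⟨A, subset_rfl, by omega, L, hL.1, hL.2.1,
        fun P hP => hL.2.2 P (Finset.mem_union_left _ hP)⟩
    have h3 := CB_card hCB (hAne.mono Finset.subset_union_left)
    omega
  refine ⟨hnot, ?_⟩
  by_contra hemp
  rw [Finset.not_nonempty_iff_eq_empty, ← Finset.disjoint_iff_inter_eq_empty] at hemp
  exact hnot (CB_of_disjoint hA hAnr hB hBnr hemp)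

end
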